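/- Fix c₀ > 0, 0 < s' < 1/2 and T > 0. There exists C > 0, independent of δ, such that for all 0 < δ < 1, 0 ≤ t ≤ T, ξ ∈ ℝ and θ ∈ [−π/2, π/2]: |G_δ(t,ξ) − G_δ(t, ξ cos θ)| ≤ C sin²(θ/2) ⟨ξ⟩^{2s'} G_δ(t, ξ cos θ) G_δ(t, ξ sin θ). -/

import Mathlib

open MeasureTheory Real

noncomputable section

/-- Japanese bracket `⟨ξ⟩ = (1+ξ²)^{1/2}`. -/
def jap (v : ℝ) : ℝ := Real.sqrt (1 + v ^ 2)

/-- The exponential mollifier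
`G_δ(t,ξ) = e^{c₀ t ⟨ξ⟩^{2s'}} / (1 + δ e^{c₀ t ⟨ξ⟩^{2s'}})`. -/
def Gmol (c₀ s' δ t ξ : ℝ) : ℝ :=
  Real.exp (c₀ * t * jap ξ ^ (2 * s')) / (1 + δ * Real.exp (c₀ * t * jap ξ ^ (2 * s')))

theorem jap_rpow_two_mul (s v : ℝ) : jap v ^ (2 * s) = (1 + v ^ 2) ^ s := by
  have h : (0 : ℝ) ≤ 1 + v ^ 2 := by positivity
  rw [jap, Real.sqrt_eq_rpow, ← Real.rpow_mul h]
  congr 1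
  ring

/-- Concavity-type bound `u^s - v^s ≤ u^s (1 - v/u)` for `0 < v ≤ u` and `s ≤ 1`. -/
theorem rpow_sub_rpow_le_mul_one_sub_div {u v s : ℝ} (hv : 0 < v) (hvu : v ≤ u) (hs : s ≤ 1) :
    u ^ s - v ^ s ≤ u ^ s * (1 - v / u) := by
  have hu : 0 < u := hv.trans_le hvu
  have h1 : v / u ≤ (v / u) ^ s := by
    simpa using Real.rpow_le_rpow_of_exponent_ge (div_pos hv hu) ((div_le_one hu).2 hvu) hs
  have h2 : v ^ s = u ^ s * (v / u) ^ s := by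
    rw [← Real.mul_rpow hu.le (div_pos hv hu).le, mul_div_cancel₀ _ hu.ne']
  rw [h2]
  nlinarith [Real.rpow_pos_of_pos hu s]

/-- The increment of `x ↦ eˣ / (1 + δ eˣ)` between `b ≤ a`, when `d ≤ a ≤ b + d`. -/
theorem abs_sub_exp_div_one_add_mul_exp_le {δ a b d : ℝ} (hδ : 0 < δ) (hba : b ≤ a)
    (hda : d ≤ a) (habd : a ≤ b + d) :
    |exp a / (1 + δ * exp a) - exp b / (1 + δ * exp b)|
      ≤ (a - b) * (exp b / (1 + δ * exp b)) * (exp d / (1 + δ * exp d)) := by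
  have hX := exp_pos a
  have hY := exp_pos b
  have hZ := exp_pos d
  have hYX : exp b ≤ exp a := exp_le_exp.2 hba
  have hZX : exp d ≤ exp a := exp_le_exp.2 hda
  have hXYZ : exp a ≤ exp b * exp d := by
    rw [← exp_add]
    exact exp_le_exp.2 habd
  have hsub : exp a - exp b ≤ (a - b) * exp a := by
    have h1 : exp b = exp a * exp (b - a) := by rw [← exp_add]; ring_nf
    have h2 := add_one_le_exp (b - a)
    rw [h1]
    nlinarith
  have hsub' : exp a - exp b ≤ (a - b) * (exp b * exp d) :=
    hsub.trans (mul_le_mul_of_nonneg_left hXYZ (sub_nonneg.2 hba))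
  have hPX : 0 < 1 + δ * exp a := by positivity
  have hPY : 0 < 1 + δ * exp b := by positivity
  have hPZ : 0 < 1 + δ * exp d := by positivity
  have hdiff : exp a / (1 + δ * exp a) - exp b / (1 + δ * exp b)
      = (exp a - exp b) / ((1 + δ * exp b) * (1 + δ * exp a)) := by
    field_simp
    ring
  have hprod : (a - b) * (exp b / (1 + δ * exp b)) * (exp d / (1 + δ * exp d))
      = (a - b) * (exp b * exp d) / ((1 + δ * exp b) * (1 + δ * exp d)) := by
    field_simp
  rw [hdiff, hprod, abs_of_nonneg (div_nonneg (sub_nonneg.2 hYX) (by positivity))]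
  have hab : 0 ≤ a - b := sub_nonneg.2 hba
  gcongr

/-- Difference estimate for the exponential mollifier:
`|G_δ(t,ξ) − G_δ(t,ξcosθ)| ≤ C sin²(θ/2) ⟨ξ⟩^{2s'} G_δ(t,ξcosθ) G_δ(t,ξsinθ)`,
uniformly in `δ ∈ (0,1)`, `t ∈ [0,T]`, `ξ ∈ ℝ`, `θ ∈ [−π/2,π/2]`. -/
theorem Gmol_difference_bound (c₀ s' T : ℝ) (hc₀ : 0 < c₀) (hs'0 : 0 < s')
    (hs' : s' < 1 / 2) (hT : 0 < T) :
    ∃ C : ℝ, 0 < C ∧ ∀ δ : ℝ, 0 < δ → δ < 1 → ∀ t : ℝ, 0 ≤ t → t ≤ T → ∀ ξ : ℝ,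
      ∀ θ ∈ Set.Icc (-(Real.pi / 2)) (Real.pi / 2),
        |Gmol c₀ s' δ t ξ - Gmol c₀ s' δ t (ξ * Real.cos θ)|
          ≤ C * Real.sin (θ / 2) ^ 2 * jap ξ ^ (2 * s')
            * Gmol c₀ s' δ t (ξ * Real.cos θ) * Gmol c₀ s' δ t (ξ * Real.sin θ) := by
  refine ⟨4 * c₀ * T, by positivity, ?_⟩
  intro δ hδ _ t ht htT ξ θ _
  have hcs := Real.sin_sq_add_cos_sq θ
  have hsin : Real.sin θ ^ 2 ≤ 4 * Real.sin (θ / 2) ^ 2 := by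
    have h : Real.sin θ = 2 * Real.sin (θ / 2) * Real.cos (θ / 2) := by
      rw [← Real.sin_two_mul]
      ring_nf
    rw [h]
    nlinarith [Real.cos_sq_le_one (θ / 2), sq_nonneg (Real.sin (θ / 2))]
  have hct : 0 ≤ c₀ * t := by positivity
  have hcos_le : 1 + (ξ * Real.cos θ) ^ 2 ≤ 1 + ξ ^ 2 := by
    nlinarith [mul_nonneg (sq_nonneg ξ) (sq_nonneg (Real.sin θ))]
  have hsin_le : 1 + (ξ * Real.sin θ) ^ 2 ≤ 1 + ξ ^ 2 := by
    nlinarith [mul_nonneg (sq_nonneg ξ) (sq_nonneg (Real.cos θ))]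
  have hsum : (1 + ξ ^ 2) ^ s'
      ≤ (1 + (ξ * Real.cos θ) ^ 2) ^ s' + (1 + (ξ * Real.sin θ) ^ 2) ^ s' := by
    refine le_trans (Real.rpow_le_rpow (by positivity) ?_ hs'0.le)
      (Real.rpow_add_le_add_rpow (by positivity) (by positivity) hs'0.le (by linarith))
    linear_combination -ξ ^ 2 * hcs
  have hdiff : (1 + ξ ^ 2) ^ s' - (1 + (ξ * Real.cos θ) ^ 2) ^ s'
      ≤ (1 + ξ ^ 2) ^ s' * (4 * Real.sin (θ / 2) ^ 2) := by
    refine (rpow_sub_rpow_le_mul_one_sub_div (by positivity) hcos_le (by linarith)).trans ?_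
    refine mul_le_mul_of_nonneg_left (le_trans ?_ hsin) (by positivity)
    have hu : 0 < 1 + ξ ^ 2 := by positivity
    rw [one_sub_div hu.ne', div_le_iff₀ hu]
    nlinarith [sq_nonneg (Real.sin θ)]
  simp only [Gmol, jap_rpow_two_mul]
  refine (abs_sub_exp_div_one_add_mul_exp_le (d := c₀ * t * (1 + (ξ * Real.sin θ) ^ 2) ^ s')
    hδ ?_ ?_ ?_).trans ?_
  · gcongr
  · gcongr
  · rw [← mul_add]
    exact mul_le_mul_of_nonneg_left hsum hct
  · gcongr
    calc c₀ * t * (1 + ξ ^ 2) ^ s' - c₀ * t * (1 + (ξ * Real.cos θ) ^ 2) ^ s'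
        = c₀ * t * ((1 + ξ ^ 2) ^ s' - (1 + (ξ * Real.cos θ) ^ 2) ^ s') := by ring
      _ ≤ c₀ * T * ((1 + ξ ^ 2) ^ s' * (4 * Real.sin (θ / 2) ^ 2)) := by
        refine (mul_le_mul_of_nonneg_left hdiff hct).trans ?_
        gcongr
      _ = 4 * c₀ * T * Real.sin (θ / 2) ^ 2 * (1 + ξ ^ 2) ^ s' := by ring
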